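/- arXiv:1301.2137 — 13 statements merged into one kernel-verified Lean document; each statement's English description precedes it below -/
import Mathlib

section
/- Let φ be a nonempty set of interpretations and V ⊆ P a set of variables. Then for every interpretation ω ∈ forget(V,φ), the distance d(ω,φ) is at most the cardinality of V. -/
/-- Hamming (Dalal) distance between two interpretations. -/
def hdist {P : Type*} [Fintype P] [DecidableEq P] (ω ω' : P → Bool) : ℕ :=
  (Finset.univ.filter fun p => ω p ≠ ω' p).card

/-- Distance from an interpretation to a knowledge base (set of models). -/
noncomputable def distToKB {P : Type*} [Fintype P] [DecidableEq P]
    (ω : P → Bool) (φ : Set (P → Bool)) : ℕ :=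
  sInf (hdist ω '' φ)

/-- Forgetting a set of variables `V` in a knowledge base `φ`. -/
def forget {P : Type*} [Fintype P] [DecidableEq P]
    (V : Finset P) (φ : Set (P → Bool)) : Set (P → Bool) :=
  {ω | ∃ ω' ∈ φ, ∀ p ∉ V, ω p = ω' p}

theorem dist_le_card_of_mem_forget
    {P : Type*} [Fintype P] [DecidableEq P]
    (φ : Set (P → Bool)) (hφ : φ.Nonempty) (V : Finset P) :
    ∀ ω ∈ forget V φ, distToKB ω φ ≤ V.card := by
  rintro ω ⟨ω', hω', h⟩
  refine (Nat.sInf_le (Set.mem_image_of_mem _ hω')).trans (Finset.card_le_card fun p hp => ?_)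
  by_contra hpV
  exact (Finset.mem_filter.mp hp).2 (h p hpV)
end

section
/- Let φ be a nonempty set of interpretations and n a natural number with 1 ≤ n ≤ |P|. Then D^n(φ) = ⋃_{V ⊆ P, |V| = n} forget(V,φ), i.e. an interpretation is at distance at most n from φ if and only if it belongs to the result of forgetting some set of exactly n variables in φ. -/
/-- The dilation operator. -/
noncomputable def dilate {P : Type*} [Fintype P] [DecidableEq P]
    (φ : Set (P → Bool)) : Set (P → Bool) :=
  {ω | distToKB ω φ ≤ 1}

section Dilation

variable {P : Type*} [Fintype P] [DecidableEq P]

theorem hdist_self (ω : P → Bool) : hdist ω ω = 0 := by simp [hdist]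

theorem hdist_triangle (ω₁ ω₂ ω₃ : P → Bool) :
    hdist ω₁ ω₃ ≤ hdist ω₁ ω₂ + hdist ω₂ ω₃ :=
  hammingDist_triangle ω₁ ω₂ ω₃

theorem distToKB_le_iff {φ : Set (P → Bool)} (hφ : φ.Nonempty) (ω : P → Bool) (n : ℕ) :
    distToKB ω φ ≤ n ↔ ∃ ω' ∈ φ, hdist ω ω' ≤ n := by
  constructor
  · intro h
    obtain ⟨ω', hω', heq⟩ := Nat.sInf_mem (hφ.image (hdist ω))
    exact ⟨ω', hω', heq.trans_le h⟩
  · rintro ⟨ω', hω', h⟩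
    exact (Nat.sInf_le (Set.mem_image_of_mem _ hω')).trans h

/-- Hamming balls have no gaps: a distance of at most `n + 1` splits as `1` plus `n`. -/
theorem exists_hdist_le_one_of_hdist_le_succ {ω ω' : P → Bool} {n : ℕ}
    (h : hdist ω ω' ≤ n + 1) : ∃ ω'', hdist ω ω'' ≤ 1 ∧ hdist ω'' ω' ≤ n := by
  by_cases heq : ω = ω'
  · exact ⟨ω, by simp [hdist_self], by simp [heq, hdist_self]⟩
  obtain ⟨p, hp⟩ := Function.ne_iff.mp heq
  refine ⟨Function.update ω p (ω' p), ?_, ?_⟩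
  · refine (Finset.card_le_card (t := {p}) fun q hq => ?_).trans_eq (Finset.card_singleton p)
    by_contra hqp
    simp_all
  · refine Nat.le_of_lt_succ (lt_of_lt_of_le (Finset.card_lt_card ?_) h)
    refine Finset.ssubset_iff_subset_ne.mpr ⟨fun q hq => ?_, fun hset => ?_⟩
    · by_cases hqp : q = p <;> simp_all
    · simpa [hp] using Finset.ext_iff.mp hset p

theorem mem_dilate_iterate_iff {φ : Set (P → Bool)} (hφ : φ.Nonempty) (n : ℕ) (ω : P → Bool) :
    ω ∈ dilate^[n] φ ↔ ∃ ω' ∈ φ, hdist ω ω' ≤ n := by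
  induction n generalizing ω with
  | zero =>
    have hzero (ω' : P → Bool) : hdist ω ω' ≤ 0 ↔ ω = ω' :=
      Nat.le_zero.trans hammingDist_eq_zero
    simp [hzero]
  | succ n ih =>
    have hne : (dilate^[n] φ).Nonempty := by
      obtain ⟨ω₀, h₀⟩ := hφ
      exact ⟨ω₀, (ih ω₀).mpr ⟨ω₀, h₀, by simp [hdist_self]⟩⟩
    rw [Function.iterate_succ_apply', dilate, Set.mem_ofPred_eq, distToKB_le_iff hne]
    constructor
    · rintro ⟨ω'', hmem, h₁⟩
      obtain ⟨ω', hω', h₂⟩ := (ih ω'').mp hmem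
      exact ⟨ω', hω', by have := hdist_triangle ω ω'' ω'; omega⟩
    · rintro ⟨ω', hω', h⟩
      obtain ⟨ω'', h₁, h₂⟩ := exists_hdist_le_one_of_hdist_le_succ h
      exact ⟨ω'', (ih ω'').mpr ⟨ω', hω', h₂⟩, h₁⟩

theorem hdist_le_iff_exists_card_eq {n : ℕ} (hn : n ≤ Fintype.card P) (ω ω' : P → Bool) :
    hdist ω ω' ≤ n ↔ ∃ V : Finset P, V.card = n ∧ ∀ p ∉ V, ω p = ω' p := by
  constructor
  · intro h
    obtain ⟨V, hsub, hcard⟩ := Finset.exists_superset_card_eq h hn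
    refine ⟨V, hcard, fun p hp => ?_⟩
    by_contra hne
    exact hp (hsub (by simpa using hne))
  · rintro ⟨V, rfl, hV⟩
    refine Finset.card_le_card fun p hp => ?_
    by_contra hpV
    exact (Finset.mem_filter.mp hp).2 (hV p hpV)

end Dilation

theorem dilate_iterate_eq_union_forget
    {P : Type*} [Fintype P] [DecidableEq P]
    (φ : Set (P → Bool)) (hφ : φ.Nonempty) (n : ℕ)
    (hn1 : 1 ≤ n) (hn2 : n ≤ Fintype.card P) :
    dilate^[n] φ = ⋃ V : Finset P, ⋃ (_ : V.card = n), forget V φ := by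
  ext ω
  simp only [mem_dilate_iterate_iff hφ, hdist_le_iff_exists_card_eq hn2, Set.mem_iUnion, forget,
    Set.mem_ofPred_eq, exists_prop]
  constructor
  · rintro ⟨ω', hω', V, hV, h⟩
    exact ⟨V, hV, ω', hω', h⟩
  · rintro ⟨V, hV, ω', hω', h⟩
    exact ⟨ω', hω', V, hV, h⟩
end

section
/- Let Φ = (φ_1,…,φ_n) be a finite list of nonempty KBs and μ a nonempty set of interpretations. Let k be the least natural number such that there exist sets V_1,…,V_n ⊆ P with |V_1| + ⋯ + |V_n| = k and (⋂_{i=1}^n forget(V_i,φ_i)) ∩ μ ≠ ∅ (such k exists). Then Δ^Σ_μ(Φ) equals the union, over all tuples (V_1,…,V_n) of subsets of P with |V_1| + ⋯ + |V_n| = k, of (⋂_{i=1}^n forget(V_i,φ_i)) ∩ μ. -/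
/-- The Σ merging operator: models of μ minimizing the sum of distances to the KBs. -/
noncomputable def deltaSigma {P : Type*} [Fintype P] [DecidableEq P] {n : ℕ}
    (μ : Set (P → Bool)) (Φ : Fin n → Set (P → Bool)) : Set (P → Bool) :=
  {ω ∈ μ | ∀ ω' ∈ μ, (∑ i, distToKB ω (Φ i)) ≤ ∑ i, distToKB ω' (Φ i)}

theorem distToKB_le_card_of_mem_forget {P : Type*} [Fintype P] [DecidableEq P]
    {ω : P → Bool} {V : Finset P} {φ : Set (P → Bool)} (h : ω ∈ forget V φ) :
    distToKB ω φ ≤ V.card := by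
  obtain ⟨ω', hω', heq⟩ := h
  refine (Nat.sInf_le (Set.mem_image_of_mem (hdist ω) hω')).trans (Finset.card_le_card fun p hp => ?_)
  by_contra hV
  exact (Finset.mem_filter.mp hp).2 (heq p hV)

theorem exists_mem_forget_card_eq_distToKB {P : Type*} [Fintype P] [DecidableEq P]
    (ω : P → Bool) {φ : Set (P → Bool)} (hφ : φ.Nonempty) :
    ∃ V : Finset P, V.card = distToKB ω φ ∧ ω ∈ forget V φ := by
  obtain ⟨ω', hω', heq⟩ := Nat.sInf_mem (hφ.image (hdist ω))
  exact ⟨Finset.univ.filter fun p => ω p ≠ ω' p, heq, ω', hω', fun p hp => by simpa using hp⟩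

theorem deltaSigma_eq_union_forget
    {P : Type*} [Fintype P] [DecidableEq P] {n : ℕ}
    (Φ : Fin n → Set (P → Bool)) (hΦ : ∀ i, (Φ i).Nonempty)
    (μ : Set (P → Bool)) (hμ : μ.Nonempty) (k : ℕ)
    (hk : IsLeast {m : ℕ | ∃ Vs : Fin n → Finset P,
      (∑ i, (Vs i).card) = m ∧ ((⋂ i, forget (Vs i) (Φ i)) ∩ μ).Nonempty} k) :
    deltaSigma μ Φ =
      ⋃ Vs : Fin n → Finset P, ⋃ (_ : (∑ i, (Vs i).card) = k),
        ((⋂ i, forget (Vs i) (Φ i)) ∩ μ) := by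
  have hle : ∀ ω ∈ μ, k ≤ ∑ i, distToKB ω (Φ i) := by
    intro ω hω
    choose Vs hcard hmem using fun i => exists_mem_forget_card_eq_distToKB ω (hΦ i)
    exact hk.2 ⟨Vs, by simp only [hcard], ω, Set.mem_iInter.mpr hmem, hω⟩
  have hge : ∀ (Vs : Fin n → Finset P) (ω : P → Bool), ω ∈ ⋂ i, forget (Vs i) (Φ i) →
      ∑ i, distToKB ω (Φ i) ≤ ∑ i, (Vs i).card := fun Vs ω hω =>
    Finset.sum_le_sum fun i _ => distToKB_le_card_of_mem_forget (Set.mem_iInter.mp hω i)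
  ext ω
  simp only [Set.mem_iUnion, exists_prop]
  constructor
  · rintro ⟨hω, hmin⟩
    obtain ⟨Ws, hWs, ν, hν, hνμ⟩ := hk.1
    choose Vs hcard hmem using fun i => exists_mem_forget_card_eq_distToKB ω (hΦ i)
    refine ⟨Vs, ?_, Set.mem_iInter.mpr hmem, hω⟩
    simp only [hcard]
    exact le_antisymm ((hmin ν hνμ).trans ((hge Ws ν hν).trans_eq hWs)) (hle ω hω)
  · rintro ⟨Vs, hVs, hmem, hω⟩
    exact ⟨hω, fun ω' hω' => ((hge Vs ω hmem).trans_eq hVs).trans (hle ω' hω')⟩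
end

section
/- Let Φ = (φ_1,…,φ_n) be a finite list of nonempty KBs and μ a nonempty set of interpretations. Let k be the least natural number such that the union, over all tuples (V_1,…,V_n) of subsets of P with |V_1| = ⋯ = |V_n| = k, of (⋂_{i=1}^n forget(V_i,φ_i)) ∩ μ is nonempty (such k exists). Then Δ^Max_μ(Φ) equals that union. -/
/-- The Max merging operator: models of μ minimizing the maximum of distances to the KBs. -/
noncomputable def deltaMax {P : Type*} [Fintype P] [DecidableEq P] {n : ℕ}
    (μ : Set (P → Bool)) (Φ : Fin n → Set (P → Bool)) : Set (P → Bool) :=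
  {ω ∈ μ | ∀ ω' ∈ μ,
    (Finset.univ.sup fun i => distToKB ω (Φ i)) ≤
      Finset.univ.sup fun i => distToKB ω' (Φ i)}

/-- A nonempty knowledge base is attained at its distance. -/
theorem exists_hdist_eq_distToKB {P : Type*} [Fintype P] [DecidableEq P]
    (ω : P → Bool) {φ : Set (P → Bool)} (hφ : φ.Nonempty) :
    ∃ ω' ∈ φ, hdist ω ω' = distToKB ω φ :=
  Nat.sInf_mem (hφ.image (hdist ω))

theorem distToKB_le_card {P : Type*} [Fintype P] [DecidableEq P]
    (ω : P → Bool) {φ : Set (P → Bool)} (hφ : φ.Nonempty) :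
    distToKB ω φ ≤ Fintype.card P := by
  obtain ⟨ω', -, h⟩ := exists_hdist_eq_distToKB ω hφ
  exact h ▸ Finset.card_le_univ _

theorem exists_card_eq_mem_forget {P : Type*} [Fintype P] [DecidableEq P]
    {ω : P → Bool} {φ : Set (P → Bool)} (hφ : φ.Nonempty) {m : ℕ}
    (hm : distToKB ω φ ≤ m) (hmP : m ≤ Fintype.card P) :
    ∃ V : Finset P, V.card = m ∧ ω ∈ forget V φ := by
  obtain ⟨ω', hω', h⟩ := exists_hdist_eq_distToKB ω hφ
  obtain ⟨V, hsub, hV⟩ := Finset.exists_superset_card_eq (h.trans_le hm) hmP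
  refine ⟨V, hV, ω', hω', fun p hp => ?_⟩
  by_contra hne
  exact hp (hsub (Finset.mem_filter.mpr ⟨Finset.mem_univ p, hne⟩))

/-- Membership in the union of forgettings of uniform size `m`, in terms of distances. -/
theorem mem_iUnion_forget_iff {P : Type*} [Fintype P] [DecidableEq P] {n : ℕ}
    {Φ : Fin n → Set (P → Bool)} (hΦ : ∀ i, (Φ i).Nonempty)
    {μ : Set (P → Bool)} {m : ℕ} {ω : P → Bool} :
    (ω ∈ ⋃ Vs : Fin n → Finset P, ⋃ (_ : ∀ i, (Vs i).card = m),
        ((⋂ i, forget (Vs i) (Φ i)) ∩ μ)) ↔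
      ω ∈ μ ∧ (Finset.univ.sup fun i => distToKB ω (Φ i)) ≤ m ∧
        (Fin n → m ≤ Fintype.card P) := by
  simp only [Set.mem_iUnion, Set.mem_inter_iff, Set.mem_iInter, exists_prop]
  constructor
  · rintro ⟨Vs, hcard, hmem, hω⟩
    exact ⟨hω, Finset.sup_le fun i _ => hcard i ▸ distToKB_le_card_of_mem_forget (hmem i),
      fun i => hcard i ▸ Finset.card_le_univ _⟩
  · rintro ⟨hω, hsup, hm⟩
    choose Vs hcard hmem using fun i => exists_card_eq_mem_forget (hΦ i)
      ((Finset.le_sup (f := fun i => distToKB ω (Φ i)) (Finset.mem_univ i)).trans hsup) (hm i)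
    exact ⟨Vs, hcard, hmem, hω⟩

theorem deltaMax_eq_union_forget
    {P : Type*} [Fintype P] [DecidableEq P] {n : ℕ}
    (Φ : Fin n → Set (P → Bool)) (hΦ : ∀ i, (Φ i).Nonempty)
    (μ : Set (P → Bool)) (hμ : μ.Nonempty) (k : ℕ)
    (hk : IsLeast {m : ℕ |
      (⋃ Vs : Fin n → Finset P, ⋃ (_ : ∀ i, (Vs i).card = m),
        ((⋂ i, forget (Vs i) (Φ i)) ∩ μ)).Nonempty} k) :
    deltaMax μ Φ =
      ⋃ Vs : Fin n → Finset P, ⋃ (_ : ∀ i, (Vs i).card = k),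
        ((⋂ i, forget (Vs i) (Φ i)) ∩ μ) := by
  obtain ⟨⟨ω₀, hω₀⟩, hmin⟩ := hk
  obtain ⟨hω₀μ, hω₀k, hkP⟩ := (mem_iUnion_forget_iff hΦ).mp hω₀
  ext ω
  rw [mem_iUnion_forget_iff hΦ]
  constructor
  · rintro ⟨hω, hle⟩
    exact ⟨hω, (hle ω₀ hω₀μ).trans hω₀k, hkP⟩
  · rintro ⟨hω, hωk, -⟩
    refine ⟨hω, fun ω' hω' => hωk.trans (hmin ⟨ω', (mem_iUnion_forget_iff hΦ).mpr ?_⟩)⟩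
    exact ⟨hω', le_rfl, fun _ => Finset.sup_le fun i _ => distToKB_le_card ω' (hΦ i)⟩
end

section
/- Let p ∈ V ⊆ P, let b : Bool, and let φ_1,…,φ_n be nonempty sets of interpretations each entailing the literal (p,b), i.e. φ_i ⊆ {ω | ω p = b} for all i. If ⋂_{i=1}^n forget(V,φ_i) is nonempty, then ⋂_{i=1}^n forget(V∖{p},φ_i) is also nonempty. -/
theorem forget_erase_consistent
    {P : Type*} [Fintype P] [DecidableEq P] {n : ℕ}
    (p : P) (V : Finset P) (hp : p ∈ V) (b : Bool)
    (Φ : Fin n → Set (P → Bool)) (hΦ : ∀ i, (Φ i).Nonempty)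
    (hent : ∀ i, Φ i ⊆ {ω | ω p = b})
    (h : (⋂ i, forget V (Φ i)).Nonempty) :
    (⋂ i, forget (V.erase p) (Φ i)).Nonempty := by
  obtain ⟨ω, hω⟩ := h
  refine ⟨Function.update ω p b, Set.mem_iInter.2 fun i => ?_⟩
  obtain ⟨ω', hω', hagree⟩ := Set.mem_iInter.1 hω i
  refine ⟨ω', hω', fun q hq => ?_⟩
  by_cases hqp : q = p
  · subst hqp
    simpa using (hent i hω').symm
  · rw [Function.update_of_ne hqp]
    exact hagree q fun hqV => hq (Finset.mem_erase.2 ⟨hqp, hqV⟩)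
end

section
/- Let φ and φ' be nonempty sets of interpretations and V ⊆ P. Then the minimum Hamming distance between an element of forget(V,φ) and an element of φ' equals the minimum Hamming distance between an element of forget(V,φ) and an element of forget(V,φ'); that is, d(forget(V,φ), φ') = d(forget(V,φ), forget(V,φ')), where for nonempty sets S, S' of interpretations d(S,S') = min_{ω∈S, ω'∈S'} d(ω,ω'). -/
/-- Minimum Hamming distance between two (nonempty) sets of interpretations. -/
noncomputable def setDist {P : Type*} [Fintype P] [DecidableEq P]
    (S S' : Set (P → Bool)) : ℕ :=
  sInf {m : ℕ | ∃ ω ∈ S, ∃ ω' ∈ S', hdist ω ω' = m}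

theorem subset_forget {P : Type*} [Fintype P] [DecidableEq P]
    (V : Finset P) (φ : Set (P → Bool)) : φ ⊆ forget V φ :=
  fun ω hω => ⟨ω, hω, fun _ _ => rfl⟩

/-- A pair of models of the two forgettings can be replaced by one that is no further apart and
whose second component is a model of the original knowledge base. -/
theorem exists_hdist_le_of_mem_forget {P : Type*} [Fintype P] [DecidableEq P]
    {V : Finset P} {φ φ' : Set (P → Bool)} {ω ω' : P → Bool}
    (hω : ω ∈ forget V φ) (hω' : ω' ∈ forget V φ') :
    ∃ υ ∈ forget V φ, ∃ υ' ∈ φ', hdist υ υ' ≤ hdist ω ω' := by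
  obtain ⟨ν, hν, hων⟩ := hω
  obtain ⟨υ', hυ', hωυ⟩ := hω'
  refine ⟨fun p => if p ∈ V then υ' p else ω p, ⟨ν, hν, fun p hp => ?_⟩, υ', hυ', ?_⟩
  · simpa [hp] using hων p hp
  · refine Finset.card_le_card fun p hp => ?_
    by_cases hpV : p ∈ V
    · simp [hpV] at hp
    · simpa [hpV, hωυ p hpV] using hp

theorem setDist_forget_eq
    {P : Type*} [Fintype P] [DecidableEq P]
    (φ φ' : Set (P → Bool)) (hφ : φ.Nonempty) (hφ' : φ'.Nonempty) (V : Finset P) :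
    setDist (forget V φ) φ' = setDist (forget V φ) (forget V φ') := by
  have hne := hφ.mono (subset_forget V φ)
  apply le_antisymm
  · obtain ⟨ω, hω, ω', hω', h⟩ := Nat.sInf_mem
      (s := {m : ℕ | ∃ ω ∈ forget V φ, ∃ ω' ∈ forget V φ', hdist ω ω' = m})
      (let ⟨ω, hω⟩ := hne
       let ⟨ω', hω'⟩ := hφ'
       ⟨_, ω, hω, ω', subset_forget V φ' hω', rfl⟩)
    obtain ⟨υ, hυ, υ', hυ', hle⟩ := exists_hdist_le_of_mem_forget hω hω'
    exact le_trans (Nat.sInf_le ⟨υ, hυ, υ', hυ', rfl⟩) (hle.trans h.le)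
  · obtain ⟨ω, hω, ω', hω', h⟩ := Nat.sInf_mem
      (s := {m : ℕ | ∃ ω ∈ forget V φ, ∃ ω' ∈ φ', hdist ω ω' = m})
      (let ⟨ω, hω⟩ := hne
       let ⟨ω', hω'⟩ := hφ'
       ⟨_, ω, hω, ω', hω', rfl⟩)
    exact Nat.sInf_le ⟨ω, hω, ω', subset_forget V φ' hω', h⟩
end

section
/- Let Φ = (φ_1,…,φ_n) be a finite list of nonempty KBs, μ a set of interpretations, p a variable and b : Bool. Suppose some φ_i ⊆ {ω | ω p = b} and some φ_j ⊆ {ω | ω p ≠ b}. Then for any V ⊆ P with p ∉ V, forget(V,φ_i) ∩ forget(V,φ_j) = ∅; consequently, every V ∈ FS1(Φ,μ) contains p, and likewise every V ∈ FS2(Φ,μ) contains p. -/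
/-- `FS1 Φ μ`: sets of variables of minimum cardinality whose forgetting makes the
intersection of the KBs with μ consistent. -/
def FS1 {P : Type*} [Fintype P] [DecidableEq P] {n : ℕ}
    (Φ : Fin n → Set (P → Bool)) (μ : Set (P → Bool)) : Set (Finset P) :=
  {V | ((⋂ i, forget V (Φ i)) ∩ μ).Nonempty ∧
    ∀ W : Finset P, ((⋂ i, forget W (Φ i)) ∩ μ).Nonempty → V.card ≤ W.card}

/-- The merging operator Δ^{f1}. -/
def deltaF1 {P : Type*} [Fintype P] [DecidableEq P] {n : ℕ}
    (μ : Set (P → Bool)) (Φ : Fin n → Set (P → Bool)) : Set (P → Bool) :=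
  ⋃ V ∈ FS1 Φ μ, ((⋂ i, forget V (Φ i)) ∩ μ)

/-- `FS2 Φ μ`: sets of variables minimal w.r.t. set inclusion whose forgetting makes the
intersection of the KBs with μ consistent. -/
def FS2 {P : Type*} [Fintype P] [DecidableEq P] {n : ℕ}
    (Φ : Fin n → Set (P → Bool)) (μ : Set (P → Bool)) : Set (Finset P) :=
  {V | ((⋂ i, forget V (Φ i)) ∩ μ).Nonempty ∧
    ∀ W : Finset P, W ⊆ V → ((⋂ i, forget W (Φ i)) ∩ μ).Nonempty → W = V}

/-- The merging operator Δ^{f2}. -/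
def deltaF2 {P : Type*} [Fintype P] [DecidableEq P] {n : ℕ}
    (μ : Set (P → Bool)) (Φ : Fin n → Set (P → Bool)) : Set (P → Bool) :=
  ⋃ V ∈ FS2 Φ μ, ((⋂ i, forget V (Φ i)) ∩ μ)

/-- If `p` is not forgotten and the value of `p` separates `φ` from `ψ`, then forgetting
keeps them disjoint. -/
theorem forget_inter_forget_eq_empty {P : Type*} [Fintype P] [DecidableEq P]
    {φ ψ : Set (P → Bool)} {p : P} {b : Bool}
    (hφ : φ ⊆ {ω | ω p = b}) (hψ : ψ ⊆ {ω | ω p ≠ b}) {V : Finset P} (hp : p ∉ V) :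
    forget V φ ∩ forget V ψ = ∅ := by
  rw [Set.eq_empty_iff_forall_notMem]
  rintro ω ⟨⟨ω₁, h₁, e₁⟩, ⟨ω₂, h₂, e₂⟩⟩
  exact hψ h₂ ((e₂ p hp).symm.trans ((e₁ p hp).trans (hφ h₁)))

/-- Any set of variables whose forgetting restores consistency contains each variable
on which two of the knowledge bases conflict. -/
theorem mem_of_iInter_forget_inter_nonempty {P : Type*} [Fintype P] [DecidableEq P] {n : ℕ}
    {Φ : Fin n → Set (P → Bool)} {μ : Set (P → Bool)} {p : P} {b : Bool} {i j : Fin n}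
    (hi : Φ i ⊆ {ω | ω p = b}) (hj : Φ j ⊆ {ω | ω p ≠ b}) {V : Finset P}
    (hV : ((⋂ i, forget V (Φ i)) ∩ μ).Nonempty) : p ∈ V := by
  by_contra hp
  obtain ⟨ω, hω, -⟩ := hV
  rw [Set.mem_iInter] at hω
  exact Set.eq_empty_iff_forall_notMem.mp (forget_inter_forget_eq_empty hi hj hp) ω
    ⟨hω i, hω j⟩

theorem forgetting_sets_contain_conflict_var
    {P : Type*} [Fintype P] [DecidableEq P] {n : ℕ}
    (Φ : Fin n → Set (P → Bool)) (hΦ : ∀ i, (Φ i).Nonempty)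
    (μ : Set (P → Bool)) (p : P) (b : Bool) (i j : Fin n)
    (hi : Φ i ⊆ {ω | ω p = b}) (hj : Φ j ⊆ {ω | ω p ≠ b}) :
    (∀ V : Finset P, p ∉ V → forget V (Φ i) ∩ forget V (Φ j) = ∅) ∧
    (∀ V ∈ FS1 Φ μ, p ∈ V) ∧
    (∀ V ∈ FS2 Φ μ, p ∈ V) := by
  exact ⟨fun _ hp => forget_inter_forget_eq_empty hi hj hp,
    fun _ hV => mem_of_iInter_forget_inter_nonempty hi hj hV.1,
    fun _ hV => mem_of_iInter_forget_inter_nonempty hi hj hV.1⟩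
end

section
/- Let Φ = (φ_1,…,φ_n) be a finite list of nonempty KBs, μ a set of interpretations, p a variable and b : Bool. Suppose there is a nonempty subfamily Φ' of Φ such that every φ' ∈ Φ' satisfies φ' ⊆ {ω | ω p = b}, every member of Φ not in Φ' is independent of p, μ is independent of p, and μ ∩ {ω | ω p = b} ≠ ∅. Then Δ^{f1}_μ(Φ) ⊆ {ω | ω p = b} ∩ μ (property A1 for Δ^{f1}). -/
/-- A set of interpretations is independent of the variable `p` iff it is closed under
switching the truth value of `p`. -/
def indepOf {P : Type*} [Fintype P] [DecidableEq P]
    (p : P) (S : Set (P → Bool)) : Prop :=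
  ∀ ω ∈ S, Function.update ω p (!ω p) ∈ S

/-- A set independent of `p` is closed under assigning any truth value to `p`. -/
theorem indepOf.update_mem {P : Type*} [Fintype P] [DecidableEq P] {p : P}
    {S : Set (P → Bool)} (hS : indepOf p S) {ω : P → Bool} (hω : ω ∈ S) (b : Bool) :
    Function.update ω p b ∈ S := by
  by_cases h : ω p = b
  · rwa [← h, Function.update_eq_self]
  · have hb : b = !ω p := by
      cases b <;> simp_all
    exact hb ▸ hS ω hω

/-- If `φ` has, for each of its models, a model with value `b` at `p` and the same values
elsewhere, then forgetting `p` is unnecessary once `p` is assigned `b`. -/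
theorem update_mem_forget_erase {P : Type*} [Fintype P] [DecidableEq P] {p : P} {b : Bool}
    {φ : Set (P → Bool)} (hφ : ∀ ω ∈ φ, Function.update ω p b ∈ φ) {V : Finset P}
    {ω : P → Bool} (hω : ω ∈ forget V φ) :
    Function.update ω p b ∈ forget (V.erase p) φ := by
  obtain ⟨ω', hω', heq⟩ := hω
  refine ⟨Function.update ω' p b, hφ ω' hω', fun q hq => ?_⟩
  by_cases hqp : q = p
  · subst hqp
    simp
  · simpa [hqp] using heq q fun hqV => hq (Finset.mem_erase.2 ⟨hqp, hqV⟩)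

theorem deltaF1_A1
    {P : Type*} [Fintype P] [DecidableEq P] {n : ℕ}
    (Φ : Fin n → Set (P → Bool)) (hΦ : ∀ i, (Φ i).Nonempty)
    (μ : Set (P → Bool)) (p : P) (b : Bool)
    (S : Finset (Fin n)) (hS : S.Nonempty)
    (hent : ∀ i ∈ S, Φ i ⊆ {ω | ω p = b})
    (hrest : ∀ i ∉ S, indepOf p (Φ i))
    (hμ : indepOf p μ)
    (hμp : (μ ∩ {ω | ω p = b}).Nonempty) :
    deltaF1 μ Φ ⊆ {ω | ω p = b} ∩ μ := by
  intro ω hω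
  simp only [deltaF1, Set.mem_iUnion] at hω
  obtain ⟨V, ⟨-, hmin⟩, hωV, hωμ⟩ := hω
  rw [Set.mem_iInter] at hωV
  have hclosed (i : Fin n) : ∀ ω ∈ Φ i, Function.update ω p b ∈ Φ i := by
    intro ω hω
    by_cases hi : i ∈ S
    · have hωp : ω p = b := hent i hi hω
      rwa [← hωp, Function.update_eq_self]
    · exact (hrest i hi).update_mem hω b
  have hpV : p ∉ V := fun hpV =>
    (Finset.card_erase_lt_of_mem hpV).not_ge <| hmin _
      ⟨Function.update ω p b,
        Set.mem_iInter.2 fun i => update_mem_forget_erase (hclosed i) (hωV i),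
        hμ.update_mem hωμ b⟩
  obtain ⟨i, hi⟩ := hS
  obtain ⟨ω', hω', heq⟩ := hωV i
  exact ⟨(heq p hpV).trans (hent i hi hω'), hωμ⟩
end

section
/- Let Φ = (φ_1,…,φ_n) be a finite list of nonempty KBs, μ a nonempty set of interpretations, p a variable and b : Bool. Suppose some φ_i ⊆ {ω | ω p = b}, some φ_j ⊆ {ω | ω p ≠ b}, and μ is independent of p. Then Δ^{f1}_μ(Φ) entails neither the literal (p,b) nor its negation: there exist ω, ω' ∈ Δ^{f1}_μ(Φ) with ω p = b and ω' p ≠ b (property A2 for Δ^{f1}). -/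
theorem update_mem_forget {P : Type*} [Fintype P] [DecidableEq P]
    {V : Finset P} {φ : Set (P → Bool)} {ω : P → Bool} {p : P} (hp : p ∈ V) (c : Bool)
    (hω : ω ∈ forget V φ) : Function.update ω p c ∈ forget V φ := by
  obtain ⟨ω', hω', h⟩ := hω
  refine ⟨ω', hω', fun q hq => ?_⟩
  rw [Function.update_of_ne (ne_of_mem_of_not_mem hp hq).symm]
  exact h q hq

theorem FS1_nonempty {P : Type*} [Fintype P] [DecidableEq P] {n : ℕ}
    {Φ : Fin n → Set (P → Bool)} (hΦ : ∀ i, (Φ i).Nonempty)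
    {μ : Set (P → Bool)} (hμ : μ.Nonempty) : (FS1 Φ μ).Nonempty := by
  obtain ⟨ω, hω⟩ := hμ
  have huniv : {V : Finset P | ((⋂ i, forget V (Φ i)) ∩ μ).Nonempty}.Nonempty := by
    refine ⟨Finset.univ, ω, Set.mem_iInter.2 fun i => ?_, hω⟩
    obtain ⟨ω', hω'⟩ := hΦ i
    exact ⟨ω', hω', fun q hq => absurd (Finset.mem_univ q) hq⟩
  obtain ⟨V, hV, hmin⟩ := Set.exists_min_image _ Finset.card (Set.toFinite _) huniv
  exact ⟨V, hV, hmin⟩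

/-- Variables on which two of the knowledge bases disagree must be forgotten. -/
theorem mem_of_mem_forget_of_mem_forget {P : Type*} [Fintype P] [DecidableEq P]
    {V : Finset P} {φ ψ : Set (P → Bool)} {ω : P → Bool} {p : P} {b : Bool}
    (hφ : φ ⊆ {ω | ω p = b}) (hψ : ψ ⊆ {ω | ω p ≠ b})
    (hωφ : ω ∈ forget V φ) (hωψ : ω ∈ forget V ψ) : p ∈ V := by
  by_contra hp
  obtain ⟨α, hα, hωα⟩ := hωφ
  obtain ⟨β, hβ, hωβ⟩ := hωψ
  exact hψ hβ ((hωβ p hp).symm.trans ((hωα p hp).trans (hφ hα)))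

theorem deltaF1_A2
    {P : Type*} [Fintype P] [DecidableEq P] {n : ℕ}
    (Φ : Fin n → Set (P → Bool)) (hΦ : ∀ i, (Φ i).Nonempty)
    (μ : Set (P → Bool)) (hμne : μ.Nonempty) (p : P) (b : Bool) (i j : Fin n)
    (hi : Φ i ⊆ {ω | ω p = b}) (hj : Φ j ⊆ {ω | ω p ≠ b})
    (hμ : indepOf p μ) :
    (∃ ω ∈ deltaF1 μ Φ, ω p = b) ∧ (∃ ω' ∈ deltaF1 μ Φ, ω' p ≠ b) := by
  obtain ⟨V, hV⟩ := FS1_nonempty hΦ hμne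
  obtain ⟨ω, hω, hωμ⟩ := hV.1
  rw [Set.mem_iInter] at hω
  have hp : p ∈ V := mem_of_mem_forget_of_mem_forget hi hj (hω i) (hω j)
  have hmem : ω ∈ deltaF1 μ Φ := Set.mem_biUnion hV ⟨Set.mem_iInter.2 hω, hωμ⟩
  have hswitch : Function.update ω p (!ω p) ∈ deltaF1 μ Φ :=
    Set.mem_biUnion hV
      ⟨Set.mem_iInter.2 fun k => update_mem_forget hp _ (hω k), hμ ω hωμ⟩
  by_cases hb : ω p = b
  · exact ⟨⟨ω, hmem, hb⟩, _, hswitch, by simp [hb]⟩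
  · exact ⟨⟨_, hswitch, by simpa [Bool.not_eq_eq_eq_not] using Bool.eq_not_of_ne hb⟩,
      ω, hmem, hb⟩
end

section
/- Let Φ = (φ_1,…,φ_n) be a finite list of nonempty KBs and μ a set of interpretations. Then: (IC0) Δ^{f1}_μ(Φ) ⊆ μ; (IC1) if μ is nonempty then Δ^{f1}_μ(Φ) is nonempty; and (IC2) if (⋂_{i=1}^n φ_i) ∩ μ is nonempty then Δ^{f1}_μ(Φ) = (⋂_{i=1}^n φ_i) ∩ μ. -/
/-- Forgetting no variables leaves a knowledge base unchanged. -/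
theorem forget_empty {P : Type*} [Fintype P] [DecidableEq P] (φ : Set (P → Bool)) :
    forget ∅ φ = φ := by
  ext ω
  constructor
  · rintro ⟨ω', hω', h⟩
    rwa [funext fun p => h p (Finset.notMem_empty p)]
  · exact fun h => ⟨ω, h, fun _ _ => rfl⟩

/-- Forgetting every variable of a consistent knowledge base yields all interpretations. -/
theorem forget_univ {P : Type*} [Fintype P] [DecidableEq P] {φ : Set (P → Bool)}
    (hφ : φ.Nonempty) : forget Finset.univ φ = Set.univ := by
  obtain ⟨ω', hω'⟩ := hφ
  exact Set.eq_univ_of_forall fun _ => ⟨ω', hω', fun p hp => absurd (Finset.mem_univ p) hp⟩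

/-- If the knowledge bases are jointly consistent with the constraint, only the empty set
of variables is a minimum forgetting set. -/
theorem FS1_eq_singleton_empty {P : Type*} [Fintype P] [DecidableEq P] {n : ℕ}
    {Φ : Fin n → Set (P → Bool)} {μ : Set (P → Bool)}
    (h : ((⋂ i, Φ i) ∩ μ).Nonempty) : FS1 Φ μ = {∅} := by
  have hempty : ((⋂ i, forget ∅ (Φ i)) ∩ μ).Nonempty := by simpa only [forget_empty] using h
  ext V
  rw [Set.mem_singleton_iff]
  constructor
  · rintro ⟨-, hmin⟩
    simpa using hmin ∅ hempty
  · rintro rfl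
    exact ⟨hempty, fun W _ => by simp⟩

theorem deltaF1_IC0_IC1_IC2
    {P : Type*} [Fintype P] [DecidableEq P] {n : ℕ}
    (Φ : Fin n → Set (P → Bool)) (hΦ : ∀ i, (Φ i).Nonempty)
    (μ : Set (P → Bool)) :
    deltaF1 μ Φ ⊆ μ ∧
    (μ.Nonempty → (deltaF1 μ Φ).Nonempty) ∧
    (((⋂ i, Φ i) ∩ μ).Nonempty → deltaF1 μ Φ = (⋂ i, Φ i) ∩ μ) := by
  refine ⟨Set.iUnion₂_subset fun _ _ => Set.inter_subset_right, fun hμ => ?_, fun h => ?_⟩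
  · obtain ⟨V, hV⟩ := FS1_nonempty hΦ hμ
    exact hV.1.mono (Set.subset_biUnion_of_mem (u := fun V => (⋂ i, forget V (Φ i)) ∩ μ) hV)
  · simp only [deltaF1, FS1_eq_singleton_empty h, Set.biUnion_singleton, forget_empty]
end

section
/- Let φ and φ' be nonempty KBs and μ a set of interpretations with φ ⊆ μ and φ' ⊆ μ. If Δ^{f1}_μ((φ,φ')) ∩ φ is nonempty, then Δ^{f1}_μ((φ,φ')) ∩ φ' is nonempty (postulate IC4 for Δ^{f1}). -/
theorem deltaF1_IC4
    {P : Type*} [Fintype P] [DecidableEq P]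
    (φ φ' : Set (P → Bool)) (hφ : φ.Nonempty) (hφ' : φ'.Nonempty)
    (μ : Set (P → Bool)) (hφμ : φ ⊆ μ) (hφ'μ : φ' ⊆ μ)
    (h : (deltaF1 μ ![φ, φ'] ∩ φ).Nonempty) :
    (deltaF1 μ ![φ, φ'] ∩ φ').Nonempty := by
  obtain ⟨ω, hω, hωφ⟩ := h
  simp only [deltaF1, Set.mem_iUnion] at hω
  obtain ⟨V, hV, hωV, -⟩ := hω
  obtain ⟨ω', hω', hagree⟩ : ω ∈ forget V φ' := Set.mem_iInter.mp hωV 1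
  refine ⟨ω', Set.mem_biUnion hV ⟨Set.mem_iInter.mpr fun i => ?_, hφ'μ hω'⟩, hω'⟩
  fin_cases i
  · exact ⟨ω, hωφ, fun p hp => (hagree p hp).symm⟩
  · exact ⟨ω', hω', fun _ _ => rfl⟩
end

section
/- Let Φ = (φ_1,…,φ_n) be a finite list of nonempty KBs and μ1, μ2 sets of interpretations. If Δ^{f1}_{μ1}(Φ) ∩ μ2 is nonempty, then Δ^{f1}_{μ1}(Φ) ∩ μ2 = Δ^{f1}_{μ1 ∩ μ2}(Φ). In particular Δ^{f1} satisfies postulates IC7 and IC8: Δ^{f1}_{μ1}(Φ) ∩ μ2 ⊆ Δ^{f1}_{μ1 ∩ μ2}(Φ) always, and Δ^{f1}_{μ1 ∩ μ2}(Φ) ⊆ Δ^{f1}_{μ1}(Φ) ∩ μ2 whenever Δ^{f1}_{μ1}(Φ) ∩ μ2 ≠ ∅. -/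
theorem mem_deltaF1 {P : Type*} [Fintype P] [DecidableEq P] {n : ℕ}
    {Φ : Fin n → Set (P → Bool)} {μ : Set (P → Bool)} {ω : P → Bool} :
    ω ∈ deltaF1 μ Φ ↔ ∃ V ∈ FS1 Φ μ, (ω ∈ ⋂ i, forget V (Φ i)) ∧ ω ∈ μ := by
  simp only [deltaF1, Set.mem_iUnion, Set.mem_inter_iff, exists_prop]

/-- A minimum forgetting set for `μ1` with a resulting model in `μ2` is also one
for `μ1 ∩ μ2`. -/
theorem mem_FS1_inter {P : Type*} [Fintype P] [DecidableEq P] {n : ℕ}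
    {Φ : Fin n → Set (P → Bool)} {μ1 μ2 : Set (P → Bool)} {V : Finset P} {ω : P → Bool}
    (hV : V ∈ FS1 Φ μ1) (hω : ω ∈ ⋂ i, forget V (Φ i)) (h1 : ω ∈ μ1) (h2 : ω ∈ μ2) :
    V ∈ FS1 Φ (μ1 ∩ μ2) :=
  ⟨⟨ω, hω, h1, h2⟩, fun W ⟨ν, hν, hν1, _⟩ => hV.2 W ⟨ν, hν, hν1⟩⟩

theorem deltaF1_IC7_IC8
    {P : Type*} [Fintype P] [DecidableEq P] {n : ℕ}
    (Φ : Fin n → Set (P → Bool)) (hΦ : ∀ i, (Φ i).Nonempty)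
    (μ1 μ2 : Set (P → Bool)) :
    (deltaF1 μ1 Φ ∩ μ2 ⊆ deltaF1 (μ1 ∩ μ2) Φ) ∧
    ((deltaF1 μ1 Φ ∩ μ2).Nonempty → deltaF1 μ1 Φ ∩ μ2 = deltaF1 (μ1 ∩ μ2) Φ) := by
  have h7 : deltaF1 μ1 Φ ∩ μ2 ⊆ deltaF1 (μ1 ∩ μ2) Φ := by
    rintro ω ⟨hω, h2⟩
    obtain ⟨V, hV, hωV, h1⟩ := mem_deltaF1.1 hω
    exact mem_deltaF1.2 ⟨V, mem_FS1_inter hV hωV h1 h2, hωV, h1, h2⟩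
  refine ⟨h7, ?_⟩
  rintro ⟨ν, hν, hν2⟩
  obtain ⟨V, hV, hνV, hν1⟩ := mem_deltaF1.1 hν
  refine h7.antisymm fun ω hω => ?_
  obtain ⟨W, hW, hωW, h1, h2⟩ := mem_deltaF1.1 hω
  have hWV : W.card ≤ V.card := hW.2 V ⟨ν, hνV, hν1, hν2⟩
  exact ⟨mem_deltaF1.2 ⟨W, ⟨⟨ω, hωW, h1⟩, fun U hU => hWV.trans (hV.2 U hU)⟩, hωW, h1⟩, h2⟩
end

section
/- Let Φ = (φ_1,…,φ_n) be a finite list of nonempty KBs and μ1, μ2 sets of interpretations. Then Δ^{f2}_{μ1}(Φ) ∩ μ2 ⊆ Δ^{f2}_{μ1 ∩ μ2}(Φ) (postulate IC7 for Δ^{f2}). -/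
theorem deltaF2_IC7
    {P : Type*} [Fintype P] [DecidableEq P] {n : ℕ}
    (Φ : Fin n → Set (P → Bool)) (hΦ : ∀ i, (Φ i).Nonempty)
    (μ1 μ2 : Set (P → Bool)) :
    deltaF2 μ1 Φ ∩ μ2 ⊆ deltaF2 (μ1 ∩ μ2) Φ := by
  rintro ω ⟨hω, hω2⟩
  simp only [deltaF2, Set.mem_iUnion] at hω ⊢
  obtain ⟨V, ⟨-, hmin⟩, hωV, hω1⟩ := hω
  exact ⟨V, ⟨⟨ω, hωV, hω1, hω2⟩, fun W hWV hW =>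
    hmin W hWV (hW.mono (Set.inter_subset_inter_right _ Set.inter_subset_left))⟩,
    hωV, hω1, hω2⟩
end
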